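/- The double integral ∫₀^∞ ∫₀^∞ exp(−(x² + xy + y²)/(4y)) · (y^{1/12} − x^{1/12}) / (x^{3/4} · y^{1/3} · log(x/y)) dx dy equals 2( log(7/4 − √3) + 2 log(csc(π/18)) ). -/

import Mathlib

open Real MeasureTheory

open Set Filter Topology

theorem tendsto_sum_real_cot {z : ℝ} (hz0 : 0 < z) (hz1 : z < 1) :
    Tendsto (fun N : ℕ => ∑ n ∈ Finset.range N, (1 / (n + z) - 1 / (n + 1 - z))) atTop
      (𝓝 (π * (cos (π * z) / sin (π * z)))) := by
  have hmem : (z : ℂ) ∈ Complex.integerComplement := by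
    rw [Complex.mem_integerComplement_iff]
    rintro ⟨n, hn⟩
    have hn' : (n : ℝ) = z := by exact_mod_cast hn
    rw [← hn'] at hz0 hz1
    have h0 : (0 : ℤ) < n := by exact_mod_cast hz0
    have h1 : n < (1 : ℤ) := by exact_mod_cast hz1
    omega
  have hC := tendsto_logDeriv_euler_cot_sub hmem
  have hR : Tendsto (fun N : ℕ => ∑ n ∈ Finset.range N, (1 / (z - (n + 1)) + 1 / (z + (n + 1))))
      atTop (𝓝 (π * (cos (π * z) / sin (π * z)) - 1 / z)) := by
    rw [← tendsto_ofReal_iff]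
    convert! hC using 2
    · simp [cotTerm]
    · simp [Complex.cot]
  have hlim : Tendsto (fun N : ℕ => 1 / (z + (N : ℝ))) atTop (𝓝 0) := by
    simp only [one_div]
    exact tendsto_inv_atTop_zero.comp
      (tendsto_atTop_add_const_left _ _ tendsto_natCast_atTop_atTop)
  have key := (hR.add_const (1 / z)).sub hlim
  simp only [sub_add_cancel, sub_zero] at key
  refine key.congr fun N => ?_
  induction N with
  | zero => simp
  | succ N ih =>
    rw [Finset.sum_range_succ, Finset.sum_range_succ, ← ih]
    have h : z - ((N : ℝ) + 1) = -(N + 1 - z) := by ring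
    rw [h, one_div_neg_eq_neg_one_div]
    push_cast
    ring

theorem integrableOn_rpow_div_Ioc {c : ℝ} (hc : -1 < c) :
    IntegrableOn (fun u : ℝ => u ^ c / (1 + u + u ^ 2)) (Ioc 0 1) := by
  have h := (intervalIntegral.intervalIntegrable_rpow' (a := 0) (b := 1) hc)
  rw [intervalIntegrable_iff_integrableOn_Ioc_of_le zero_le_one] at h
  refine Integrable.mono' h (Measurable.aestronglyMeasurable (by fun_prop)) ?_
  filter_upwards [ae_restrict_mem measurableSet_Ioc] with u hu
  have hu0 := hu.1
  have hp := rpow_pos_of_pos hu0 c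
  rw [norm_of_nonneg (by positivity)]
  exact div_le_self hp.le (by nlinarith)

theorem rpow_div_le_rpow_sub_two {c u : ℝ} (hu : 0 < u) :
    u ^ c / (1 + u + u ^ 2) ≤ u ^ (c - 2) := by
  have hp := rpow_pos_of_pos hu c
  have h : u ^ (c - 2) = u ^ c / u ^ 2 := by
    rw [rpow_sub hu]; norm_num
  rw [h]
  gcongr
  linarith

theorem integrableOn_rpow_div_Ioi_one {c : ℝ} (hc : c < 1) :
    IntegrableOn (fun u : ℝ => u ^ c / (1 + u + u ^ 2)) (Ioi 1) := by
  have h := integrableOn_Ioi_rpow_of_lt (a := c - 2) (c := 1) (by linarith) one_pos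
  refine Integrable.mono' h (Measurable.aestronglyMeasurable (by fun_prop)) ?_
  filter_upwards [ae_restrict_mem measurableSet_Ioi] with u hu
  have hu0 : 0 < u := one_pos.trans hu
  rw [norm_of_nonneg (by positivity)]
  exact rpow_div_le_rpow_sub_two hu0

theorem integrableOn_rpow_div_Ioi {c : ℝ} (hc : -1 < c) (hc1 : c < 1) :
    IntegrableOn (fun u : ℝ => u ^ c / (1 + u + u ^ 2)) (Ioi 0) := by
  rw [← Ioc_union_Ioi_eq_Ioi zero_le_one]
  exact (integrableOn_rpow_div_Ioc hc).union (integrableOn_rpow_div_Ioi_one hc1)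

theorem integral_Ioc_zero_one_rpow {c : ℝ} (hc : -1 < c) :
    ∫ u in Ioc (0 : ℝ) 1, u ^ c = 1 / (c + 1) := by
  rw [← intervalIntegral.integral_of_le zero_le_one, integral_rpow (Or.inl hc), one_rpow,
    zero_rpow (by linarith), sub_zero]

theorem integral_Ioi_one_rpow {c : ℝ} (hc : c < -1) :
    ∫ u in Ioi (1 : ℝ), u ^ c = 1 / (-1 - c) := by
  rw [integral_Ioi_rpow_of_lt hc one_pos, one_rpow, neg_div, ← div_neg]
  congr 1
  ring

theorem integral_rpow_div_Ioc_add_three {c : ℝ} (hc : -1 < c) :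
    ∫ u in Ioc (0 : ℝ) 1, u ^ c / (1 + u + u ^ 2) =
      1 / (c + 1) - 1 / (c + 2) + ∫ u in Ioc (0 : ℝ) 1, u ^ (c + 3) / (1 + u + u ^ 2) := by
  have hI : ∀ d : ℝ, -1 < d → IntegrableOn (fun u : ℝ => u ^ d) (Ioc 0 1) := fun d hd => by
    have h := (intervalIntegral.intervalIntegrable_rpow' (a := 0) (b := 1) hd)
    rwa [intervalIntegrable_iff_integrableOn_Ioc_of_le zero_le_one] at h
  have h1 := hI c hc
  have h2 := hI (c + 1) (by linarith)
  have h3 := integrableOn_rpow_div_Ioc (c := c + 3) (by linarith)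
  rw [show c + 2 = (c + 1) + 1 by ring, ← integral_Ioc_zero_one_rpow hc,
    ← integral_Ioc_zero_one_rpow (c := c + 1) (by linarith), ← integral_sub h1 h2]
  refine Eq.trans ?_ (integral_add (h1.sub h2) h3)
  refine setIntegral_congr_fun measurableSet_Ioc fun u hu => ?_
  have hu0 := hu.1
  have e1 : u ^ (c + 1) = u ^ c * u := by rw [rpow_add hu0, rpow_one]
  have e3 : u ^ (c + 3) = u ^ c * u ^ 3 := by rw [rpow_add hu0]; norm_num
  simp only [e1, e3]
  field_simp
  ring

theorem integral_rpow_div_Ioi_one_sub_three {c : ℝ} (hc : c < 1) :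
    ∫ u in Ioi (1 : ℝ), u ^ c / (1 + u + u ^ 2) =
      1 / (1 - c) - 1 / (2 - c) + ∫ u in Ioi (1 : ℝ), u ^ (c - 3) / (1 + u + u ^ 2) := by
  have h1 := integrableOn_Ioi_rpow_of_lt (a := c - 2) (c := 1) (by linarith) one_pos
  have h2 := integrableOn_Ioi_rpow_of_lt (a := c - 3) (c := 1) (by linarith) one_pos
  have h3 := integrableOn_rpow_div_Ioi_one (c := c - 3) (by linarith)
  rw [show 1 - c = -1 - (c - 2) by ring, show 2 - c = -1 - (c - 3) by ring,
    ← integral_Ioi_one_rpow (c := c - 2) (by linarith),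
    ← integral_Ioi_one_rpow (c := c - 3) (by linarith), ← integral_sub h1 h2]
  refine Eq.trans ?_ (integral_add (h1.sub h2) h3)
  refine setIntegral_congr_fun measurableSet_Ioi fun u hu => ?_
  have hu0 : 0 < u := one_pos.trans hu
  have e2 : u ^ (c - 2) = u ^ c / u ^ 2 := by rw [rpow_sub hu0]; norm_num
  have e3 : u ^ (c - 3) = u ^ c / u ^ 3 := by rw [rpow_sub hu0]; norm_num
  simp only [e2, e3]
  field_simp
  ring

theorem integral_rpow_div_eq_sum_add {b : ℝ} (hb : -1 < b) (hb1 : b < 1) (N : ℕ) :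
    ∫ u in Ioi (0 : ℝ), u ^ b / (1 + u + u ^ 2) =
      ∑ n ∈ Finset.range N, ((1 / (b + 3 * n + 1) - 1 / (b + 3 * n + 2)) +
        (1 / (1 - (b - 3 * n)) - 1 / (2 - (b - 3 * n)))) +
      ((∫ u in Ioc (0 : ℝ) 1, u ^ (b + 3 * N) / (1 + u + u ^ 2)) +
        ∫ u in Ioi (1 : ℝ), u ^ (b - 3 * N) / (1 + u + u ^ 2)) := by
  induction N with
  | zero =>
    simp only [Finset.range_zero, Finset.sum_empty, Nat.cast_zero, mul_zero, add_zero, sub_zero,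
      zero_add]
    rw [← Ioc_union_Ioi_eq_Ioi zero_le_one]
    exact setIntegral_union (Set.Ioc_disjoint_Ioi le_rfl) measurableSet_Ioi
      (integrableOn_rpow_div_Ioc hb) (integrableOn_rpow_div_Ioi_one hb1)
  | succ N ih =>
    have hN : (0 : ℝ) ≤ N := N.cast_nonneg
    rw [ih, integral_rpow_div_Ioc_add_three (c := b + 3 * N) (by linarith),
      integral_rpow_div_Ioi_one_sub_three (c := b - 3 * N) (by linarith), Finset.sum_range_succ]
    push_cast
    rw [show b + 3 * ((N : ℝ) + 1) = b + 3 * N + 3 by ring,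
      show b - 3 * ((N : ℝ) + 1) = b - 3 * N - 3 by ring]
    ring

theorem integral_rpow_div_Ioi {b : ℝ} (hb : -1 < b) (hb1 : b < 1) :
    ∫ u in Ioi (0 : ℝ), u ^ b / (1 + u + u ^ 2) =
      π / 3 * (cos (π * ((1 + b) / 3)) / sin (π * ((1 + b) / 3)) +
        cos (π * ((1 - b) / 3)) / sin (π * ((1 - b) / 3))) := by
  have hz := tendsto_sum_real_cot (z := (1 + b) / 3) (by linarith) (by linarith)
  have hw := tendsto_sum_real_cot (z := (1 - b) / 3) (by linarith) (by linarith)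
  have hsum := (hz.add hw).div_const 3
  have hJ : Tendsto (fun N : ℕ => ∫ u in Ioc (0 : ℝ) 1, u ^ (b + 3 * N) / (1 + u + u ^ 2))
      atTop (𝓝 0) := by
    have hlim : Tendsto (fun N : ℕ => 1 / (b + 3 * (N : ℝ) + 1)) atTop (𝓝 0) := by
      simp only [one_div]
      exact tendsto_inv_atTop_zero.comp (tendsto_atTop_add_const_right _ _
        (tendsto_atTop_add_const_left _ _
          (tendsto_natCast_atTop_atTop.const_mul_atTop (by norm_num))))
    refine squeeze_zero (fun N => ?_) (fun N => ?_) hlim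
    · exact setIntegral_nonneg measurableSet_Ioc fun u hu => by have := hu.1; positivity
    · have hN : (0 : ℝ) ≤ N := N.cast_nonneg
      rw [← integral_Ioc_zero_one_rpow (c := b + 3 * N) (by linarith)]
      have h := (intervalIntegral.intervalIntegrable_rpow' (a := 0) (b := 1)
        (r := b + 3 * N) (by linarith))
      rw [intervalIntegrable_iff_integrableOn_Ioc_of_le zero_le_one] at h
      refine setIntegral_mono_on (integrableOn_rpow_div_Ioc (by linarith)) h measurableSet_Ioc
        fun u hu => ?_
      have hu0 := hu.1
      exact div_le_self (rpow_pos_of_pos hu0 _).le (by nlinarith)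
  have hL : Tendsto (fun N : ℕ => ∫ u in Ioi (1 : ℝ), u ^ (b - 3 * N) / (1 + u + u ^ 2))
      atTop (𝓝 0) := by
    have hlim : Tendsto (fun N : ℕ => 1 / (1 - b + 3 * (N : ℝ))) atTop (𝓝 0) := by
      simp only [one_div]
      exact tendsto_inv_atTop_zero.comp (tendsto_atTop_add_const_left _ _
          (tendsto_natCast_atTop_atTop.const_mul_atTop (by norm_num)))
    refine squeeze_zero (fun N => ?_) (fun N => ?_) hlim
    · exact setIntegral_nonneg measurableSet_Ioi fun u hu => by
        have : 0 < u := one_pos.trans hu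
        positivity
    · have hN : (0 : ℝ) ≤ N := N.cast_nonneg
      rw [show 1 - b + 3 * (N : ℝ) = -1 - (b - 3 * N - 2) by ring,
        ← integral_Ioi_one_rpow (c := b - 3 * N - 2) (by linarith)]
      exact setIntegral_mono_on (integrableOn_rpow_div_Ioi_one (by linarith))
        (integrableOn_Ioi_rpow_of_lt (by linarith) one_pos) measurableSet_Ioi
        fun u hu => rpow_div_le_rpow_sub_two (one_pos.trans hu)
  have hall := hsum.add (hJ.add hL)
  rw [add_zero, add_zero] at hall
  have hconst := (tendsto_const_nhds (x := ∫ u in Ioi (0 : ℝ), u ^ b / (1 + u + u ^ 2))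
    (f := (atTop : Filter ℕ)))
  have := tendsto_nhds_unique (hconst.congr fun N => ?_) hall
  · rw [this]; ring
  · rw [integral_rpow_div_eq_sum_add hb hb1 N]
    congr 1
    rw [← Finset.sum_add_distrib, Finset.sum_div]
    refine Finset.sum_congr rfl fun n _ => ?_
    rw [show (n : ℝ) + (1 + b) / 3 = (b + 3 * n + 1) / 3 by ring,
      show (n : ℝ) + 1 - (1 + b) / 3 = (2 - (b - 3 * n)) / 3 by ring,
      show (n : ℝ) + (1 - b) / 3 = (1 - (b - 3 * n)) / 3 by ring,
      show (n : ℝ) + 1 - (1 - b) / 3 = (b + 3 * n + 2) / 3 by ring]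
    simp only [one_div_div]
    ring

theorem integral_rpow_exponent {u p q : ℝ} (hu : 0 < u) (hu1 : u ≠ 1) :
    ∫ b in p..q, u ^ b = (u ^ q - u ^ p) / log u := by
  have hl : log u ≠ 0 := log_ne_zero_of_pos_of_ne_one hu hu1
  have hd : ∀ b ∈ uIcc p q, HasDerivAt (fun b : ℝ => u ^ b / log u) (u ^ b) b := fun b _ => by
    have h := ((hasStrictDerivAt_const_rpow hu b).hasDerivAt).div_const (log u)
    rwa [mul_div_cancel_right₀ _ hl] at h
  rw [intervalIntegral.integral_eq_sub_of_hasDerivAt hd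
    ((continuous_const_rpow hu.ne').intervalIntegrable _ _), sub_div]

theorem integrable_rpow_div_prod {p q : ℝ} (hp : -1 < p) (hpq : p ≤ q) (hq : q < 1) :
    Integrable (fun z : ℝ × ℝ => z.1 ^ z.2 / (1 + z.1 + z.1 ^ 2))
      ((volume.restrict (Ioi 0)).prod (volume.restrict (Ioc p q))) := by
  have hdom := ((integrableOn_rpow_div_Ioi hp (hpq.trans_lt hq)).add
    (integrableOn_rpow_div_Ioi (hp.trans_le hpq) hq)).comp_fst (volume.restrict (Ioc p q))
  refine hdom.mono' (Measurable.aestronglyMeasurable (by fun_prop)) ?_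
  rw [Measure.prod_restrict]
  filter_upwards [ae_restrict_mem (measurableSet_Ioi.prod measurableSet_Ioc)] with z hz
  obtain ⟨hz1, hz2⟩ := hz
  have hu : 0 < z.1 := hz1
  rw [norm_of_nonneg (by positivity), Pi.add_apply, ← add_div]
  gcongr
  have h1 := rpow_pos_of_pos hu p
  have h2 := rpow_pos_of_pos hu q
  rcases le_total 1 z.1 with h | h
  · linarith [rpow_le_rpow_of_exponent_le h hz2.2]
  · linarith [rpow_le_rpow_of_exponent_ge hu h hz2.1.le]

theorem integral_cot_add_cot {p q : ℝ} (hp : -1 < p) (hpq : p ≤ q) (hq : q < 1) :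
    ∫ b in p..q, π / 3 * (cos (π * ((1 + b) / 3)) / sin (π * ((1 + b) / 3)) +
        cos (π * ((1 - b) / 3)) / sin (π * ((1 - b) / 3))) =
      (log (sin (π * ((1 + q) / 3))) - log (sin (π * ((1 - q) / 3)))) -
      (log (sin (π * ((1 + p) / 3))) - log (sin (π * ((1 - p) / 3)))) := by
  have hs : ∀ t : ℝ, 0 < t → t < 1 → sin (π * t) ≠ 0 := fun t h0 h1 =>
    (sin_pos_of_pos_of_lt_pi (by positivity) (by nlinarith [pi_pos])).ne'
  have hA : ∀ b ∈ uIcc p q, sin (π * ((1 + b) / 3)) ≠ 0 := fun b hb => by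
    rw [uIcc_of_le hpq] at hb
    exact hs _ (by linarith [hb.1]) (by linarith [hb.2])
  have hB : ∀ b ∈ uIcc p q, sin (π * ((1 - b) / 3)) ≠ 0 := fun b hb => by
    rw [uIcc_of_le hpq] at hb
    exact hs _ (by linarith [hb.2]) (by linarith [hb.1])
  refine intervalIntegral.integral_eq_sub_of_hasDerivAt
    (f := fun b => log (sin (π * ((1 + b) / 3))) - log (sin (π * ((1 - b) / 3))))
    (fun b hb => ?_) ?_
  · have d1 : HasDerivAt (fun b : ℝ => π * ((1 + b) / 3)) (π * (1 / 3)) b :=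
      (((hasDerivAt_id b).const_add 1).div_const 3).const_mul π
    have d2 : HasDerivAt (fun b : ℝ => π * ((1 - b) / 3)) (π * (-1 / 3)) b :=
      (((hasDerivAt_id b).const_sub 1).div_const 3).const_mul π
    convert! (d1.sin.log (hA b hb)).sub (d2.sin.log (hB b hb)) using 1
    ring
  · refine ContinuousOn.intervalIntegrable ?_
    refine continuousOn_const.mul (ContinuousOn.add ?_ ?_)
    · exact ContinuousOn.div (by fun_prop) (by fun_prop) hA
    · exact ContinuousOn.div (by fun_prop) (by fun_prop) hB

theorem integral_rpow_sub_rpow_div_log {p q : ℝ} (hp : -1 < p) (hpq : p ≤ q) (hq : q < 1) :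
    IntegrableOn (fun u : ℝ => (u ^ q - u ^ p) / log u / (1 + u + u ^ 2)) (Ioi 0) ∧
    ∫ u in Ioi (0 : ℝ), (u ^ q - u ^ p) / log u / (1 + u + u ^ 2) =
      (log (sin (π * ((1 + q) / 3))) - log (sin (π * ((1 - q) / 3)))) -
      (log (sin (π * ((1 + p) / 3))) - log (sin (π * ((1 - p) / 3)))) := by
  have hInt := integrable_rpow_div_prod hp hpq hq
  have hae : (fun u : ℝ => ∫ b in Ioc p q, u ^ b / (1 + u + u ^ 2))
      =ᵐ[volume.restrict (Ioi 0)] fun u => (u ^ q - u ^ p) / log u / (1 + u + u ^ 2) := by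
    have hne : ∀ᵐ u : ℝ ∂volume.restrict (Ioi 0), u ≠ 1 :=
      ae_restrict_of_ae (Measure.ae_ne volume 1)
    filter_upwards [ae_restrict_mem measurableSet_Ioi, hne] with u hu hu1
    rw [integral_div, ← intervalIntegral.integral_of_le hpq, integral_rpow_exponent hu hu1]
  refine ⟨(hInt.integral_prod_left).congr hae, ?_⟩
  rw [← integral_congr_ae hae, integral_integral_swap hInt, ← integral_cot_add_cot hp hpq hq,
    intervalIntegral.integral_of_le hpq]
  refine setIntegral_congr_fun measurableSet_Ioc fun b hb => ?_
  exact integral_rpow_div_Ioi (hp.trans hb.1) (hb.2.trans_lt hq)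

theorem integral_exp_mul_swap {w g : ℝ → ℝ} (hw : Measurable w) (hg : Measurable g)
    (hpos : ∀ u ∈ Ioi (0 : ℝ), 0 < w u) (hInt : IntegrableOn (fun u => g u / w u) (Ioi 0)) :
    ∫ x in Ioi (0 : ℝ), ∫ u in Ioi (0 : ℝ), exp (-w u * x) * g u =
      ∫ u in Ioi (0 : ℝ), g u / w u := by
  have hexp : ∀ u ∈ Ioi (0 : ℝ), ∫ x in Ioi (0 : ℝ), exp (-w u * x) = 1 / w u := fun u hu => by
    rw [integral_exp_mul_Ioi (neg_neg_of_pos (hpos u hu))]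
    simp [neg_div_neg_eq]
  rw [integral_integral_swap]
  · refine setIntegral_congr_fun measurableSet_Ioi fun u hu => ?_
    rw [integral_mul_const, hexp u hu]
    ring
  · have hm : Measurable (Function.uncurry fun x u : ℝ => exp (-w u * x) * g u) := by
      unfold Function.uncurry
      fun_prop
    rw [integrable_prod_iff' hm.aestronglyMeasurable]
    refine ⟨?_, ?_⟩
    · filter_upwards [ae_restrict_mem measurableSet_Ioi] with u hu
      exact (exp_neg_integrableOn_Ioi 0 (hpos u hu)).mul_const (g u)
    · refine hInt.norm.congr ?_
      filter_upwards [ae_restrict_mem measurableSet_Ioi] with u hu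
      simp only [Function.uncurry, norm_mul, norm_div, norm_of_nonneg (exp_pos _).le]
      rw [integral_mul_const, hexp u hu, norm_of_nonneg (hpos u hu).le]
      ring

theorem integrand_comp_mul {x u : ℝ} (hx : 0 < x) (hu : 0 < u) :
    x * (exp (-(x ^ 2 + x * (x * u) + (x * u) ^ 2) / (4 * (x * u))) *
        ((x * u) ^ ((1 : ℝ) / 12) - x ^ ((1 : ℝ) / 12)) /
        (x ^ ((3 : ℝ) / 4) * (x * u) ^ ((1 : ℝ) / 3) * log (x / (x * u)))) =
      exp (-((1 + u + u ^ 2) / (4 * u)) * x) *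
        ((1 - u ^ ((1 : ℝ) / 12)) / (u ^ ((1 : ℝ) / 3) * log u)) := by
  have e1 : -(x ^ 2 + x * (x * u) + (x * u) ^ 2) / (4 * (x * u)) =
      -((1 + u + u ^ 2) / (4 * u)) * x := by
    field_simp
  have e2 : log (x / (x * u)) = -log u := by
    rw [div_mul_cancel_left₀ hx.ne', log_inv]
  have e3 : x ^ ((3 : ℝ) / 4) * x ^ ((1 : ℝ) / 3) = x * x ^ ((1 : ℝ) / 12) := by
    nth_rewrite 3 [← rpow_one x]
    rw [← rpow_add hx, ← rpow_add hx]
    norm_num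
  rw [e1, e2, mul_rpow hx.le hu.le, mul_rpow hx.le hu.le, ← mul_assoc (x ^ ((3 : ℝ) / 4)), e3]
  have h1 := rpow_pos_of_pos hx ((1 : ℝ) / 12)
  have h2 := rpow_pos_of_pos hu ((1 : ℝ) / 3)
  rcases eq_or_ne (log u) 0 with hl | hl
  · simp [hl]
  · generalize x ^ ((1 : ℝ) / 12) = X at *
    generalize u ^ ((1 : ℝ) / 3) = U at *
    field_simp
    ring

theorem sin_special_values :
    (log (sin (π * ((1 + 3 / 4) / 3))) - log (sin (π * ((1 - 3 / 4) / 3)))) -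
      (log (sin (π * ((1 + 2 / 3) / 3))) - log (sin (π * ((1 - 2 / 3) / 3)))) =
    log (2 + √3) + log 2 + log (sin (π / 18)) := by
  have hp := pi_pos
  have hs : 0 < sin (π / 18) := sin_pos_of_pos_of_lt_pi (by positivity) (by linarith)
  have hc : 0 < cos (π / 18) := cos_pos_of_mem_Ioo ⟨by linarith, by linarith⟩
  have hs' : 0 < sin (π / 12) := sin_pos_of_pos_of_lt_pi (by positivity) (by linarith)
  have h3 : √3 * √3 = 3 := mul_self_sqrt (by norm_num)
  have e1 : sin (π * ((1 + 3 / 4) / 3)) = (2 + √3) * sin (π / 12) := by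
    rw [show π * ((1 + 3 / 4) / 3) = π / 3 + π / 4 by ring,
      show π / 12 = π / 3 - π / 4 by ring, sin_add, sin_sub, sin_pi_div_three, cos_pi_div_three,
      sin_pi_div_four, cos_pi_div_four]
    linear_combination (-√2 / 4) * h3
  have e2 : sin (π * ((1 - 3 / 4) / 3)) = sin (π / 12) := by congr 1; ring
  have e3 : sin (π * ((1 + 2 / 3) / 3)) = cos (π / 18) := by
    rw [show π * ((1 + 2 / 3) / 3) = π / 18 + π / 2 by ring, sin_add_pi_div_two]
  have e4 : sin (π * ((1 - 2 / 3) / 3)) = 2 * sin (π / 18) * cos (π / 18) := by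
    rw [show π * ((1 - 2 / 3) / 3) = 2 * (π / 18) by ring, sin_two_mul]
  rw [e1, e2, e3, e4, log_mul (by positivity) hs'.ne', log_mul (by positivity) hc.ne',
    log_mul two_ne_zero hs.ne']
  ring

theorem log_seven_fourths_sub_sqrt_three :
    log (7 / 4 - √3) = -2 * log (2 + √3) - 2 * log 2 := by
  have h3 : √3 * √3 = 3 := mul_self_sqrt (by norm_num)
  have h : 7 / 4 - √3 = ((2 + √3) ^ 2 * 2 ^ 2)⁻¹ := by
    refine eq_inv_of_mul_eq_one_left ?_
    linear_combination (-4 * √3 - 9) * h3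
  rw [h, log_inv, log_mul (by positivity) (by positivity), log_pow, log_pow]
  push_cast
  ring

theorem stmt4 :
    (∫ x in Set.Ioi (0:ℝ), ∫ y in Set.Ioi (0:ℝ),
      Real.exp (-(x^2 + x*y + y^2) / (4*y)) *
        (y ^ ((1:ℝ)/12) - x ^ ((1:ℝ)/12)) /
        (x ^ ((3:ℝ)/4) * y ^ ((1:ℝ)/3) * Real.log (x/y)))
    = 2 * (Real.log (7/4 - Real.sqrt 3) + 2 * Real.log (1 / Real.sin (π/18))) := by
  obtain ⟨hInt, hval⟩ := integral_rpow_sub_rpow_div_log (p := 2 / 3) (q := 3 / 4)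
    (by norm_num) (by norm_num) (by norm_num)
  have hfun : ∀ u ∈ Ioi (0 : ℝ), -4 * ((u ^ ((3 : ℝ) / 4) - u ^ ((2 : ℝ) / 3)) / log u /
      (1 + u + u ^ 2)) = (1 - u ^ ((1 : ℝ) / 12)) / (u ^ ((1 : ℝ) / 3) * log u) /
        ((1 + u + u ^ 2) / (4 * u)) := fun u hu => by
    have hu0 : 0 < u := hu
    have h1 : u ^ ((3 : ℝ) / 4) = u ^ ((2 : ℝ) / 3) * u ^ ((1 : ℝ) / 12) := by
      rw [← rpow_add hu0]; norm_num
    have h2 : u = u ^ ((2 : ℝ) / 3) * u ^ ((1 : ℝ) / 3) := by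
      rw [← rpow_add hu0]; norm_num
    have h3 := rpow_pos_of_pos hu0 ((1 : ℝ) / 3)
    have h4 : u / u ^ ((1 : ℝ) / 3) = u ^ ((2 : ℝ) / 3) := by
      rw [div_eq_iff h3.ne', ← h2]
    rw [h1, ← h4]
    rcases eq_or_ne (log u) 0 with hl | hl
    · simp [hl]
    · field_simp
      ring
  have hsub : ∀ x ∈ Ioi (0 : ℝ), ∫ y in Ioi (0 : ℝ), exp (-(x ^ 2 + x * y + y ^ 2) / (4 * y)) *
        (y ^ ((1 : ℝ) / 12) - x ^ ((1 : ℝ) / 12)) /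
        (x ^ ((3 : ℝ) / 4) * y ^ ((1 : ℝ) / 3) * log (x / y)) =
      ∫ u in Ioi (0 : ℝ), exp (-((1 + u + u ^ 2) / (4 * u)) * x) *
        ((1 - u ^ ((1 : ℝ) / 12)) / (u ^ ((1 : ℝ) / 3) * log u)) := fun x hx => by
    have h := integral_comp_mul_left_Ioi' (fun y => exp (-(x ^ 2 + x * y + y ^ 2) / (4 * y)) *
        (y ^ ((1 : ℝ) / 12) - x ^ ((1 : ℝ) / 12)) /
        (x ^ ((3 : ℝ) / 4) * y ^ ((1 : ℝ) / 3) * log (x / y))) 0 hx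
    rw [mul_zero] at h
    rw [← h, smul_eq_mul, ← integral_const_mul]
    exact setIntegral_congr_fun measurableSet_Ioi fun u hu => integrand_comp_mul hx hu
  rw [setIntegral_congr_fun measurableSet_Ioi hsub,
    integral_exp_mul_swap (w := fun u => (1 + u + u ^ 2) / (4 * u))
      (g := fun u => (1 - u ^ ((1 : ℝ) / 12)) / (u ^ ((1 : ℝ) / 3) * log u))
      (by fun_prop) (by fun_prop)
      (fun u hu => by have : 0 < u := hu; positivity)
      (IntegrableOn.congr_fun (hInt.const_mul (-4)) hfun measurableSet_Ioi),
    ← setIntegral_congr_fun measurableSet_Ioi hfun, integral_const_mul, hval,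
    sin_special_values, log_seven_fourths_sub_sqrt_three, one_div, log_inv]
  ring
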